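/- Fix n ≥ 0 and let Δ_n := {(t₁,…,t_n) ∈ ℝⁿ : 0 ≤ t₁ ≤ ⋯ ≤ t_n ≤ 1} and Δ_{n+1} := {(τ₁,…,τ_{n+1}) ∈ ℝ^{n+1} : 0 ≤ τ₁ ≤ ⋯ ≤ τ_{n+1} ≤ 1}. For 1 ≤ j ≤ n+1 set D_j := {(s,t₁,…,t_n) : (t₁,…,t_n) ∈ Δ_n, s ∈ [0,1], t_{j−1} + s ≤ 1 and t_j + s ≥ 1}, with the conventions t₀ := 0 and t_{n+1} := 1. Then: (1) ∪_{j=1}^{n+1} D_j = [0,1] × Δ_n; (2) for j ≠ k the intersection D_j ∩ D_k has (n+1)-dimensional Lebesgue measure zero; (3) for each j, the affine map Φ_j(s,t₁,…,t_n) = (τ₁,…,τ_{n+1}) defined by τ_k := t_{j+k−1} + s − 1 for 1 ≤ k ≤ n+1−j, τ_{n+2−j} := s, and τ_k := t_{k+j−n−2} + s for n+3−j ≤ k ≤ n+1, is a bijection from D_j onto Δ_{n+1} up to Lebesgue-null sets and preserves (n+1)-dimensional Lebesgue measure. -/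

import Mathlib

open MeasureTheory

/-- The standard ordered simplex `Δ_m = {0 ≤ τ₁ ≤ ⋯ ≤ τ_m ≤ 1} ⊆ ℝᵐ`. -/
def simplex01 (m : ℕ) : Set (Fin m → ℝ) :=
  {τ | (∀ i, 0 ≤ τ i ∧ τ i ≤ 1) ∧ ∀ i j : Fin m, i ≤ j → τ i ≤ τ j}

/-- The coordinates `t₁,…,t_n` of a point of `ℝⁿ`, extended by the conventions `t₀ := 0` and
`t_m := 1` for `m ≥ n+1` (`1`-based indexing). -/
def extCoord (n : ℕ) (t : Fin n → ℝ) : ℕ → ℝ := fun m =>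
  if h : 1 ≤ m ∧ m ≤ n then t ⟨m - 1, by omega⟩ else if m = 0 then 0 else 1

/-- The piece `D_j = {(s,t₁,…,t_n) : t ∈ Δ_n, s ∈ [0,1], t_{j−1} + s ≤ 1, t_j + s ≥ 1}`
of the prism `[0,1] × Δ_n` (conventions `t₀ = 0`, `t_{n+1} = 1`). -/
def prismPiece (n j : ℕ) : Set (ℝ × (Fin n → ℝ)) :=
  {p | p.2 ∈ simplex01 n ∧ p.1 ∈ Set.Icc (0:ℝ) 1 ∧
       extCoord n p.2 (j - 1) + p.1 ≤ 1 ∧ 1 ≤ extCoord n p.2 j + p.1}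

/-- The affine map `Φ_j(s,t₁,…,t_n) = (τ₁,…,τ_{n+1})` given by `τ_k := t_{j+k−1} + s − 1` for
`1 ≤ k ≤ n+1−j`, `τ_{n+2−j} := s`, and `τ_k := t_{k+j−n−2} + s` for `n+3−j ≤ k ≤ n+1`. -/
def prismMap (n j : ℕ) (p : ℝ × (Fin n → ℝ)) : Fin (n + 1) → ℝ := fun k =>
  if (k : ℕ) + 1 ≤ n + 1 - j then extCoord n p.2 (j + ((k : ℕ) + 1) - 1) + p.1 - 1
  else if (k : ℕ) + 1 = n + 2 - j then p.1
  else extCoord n p.2 ((k : ℕ) + 1 + j - n - 2) + p.1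

lemma extCoord_zero (n : ℕ) (t : Fin n → ℝ) : extCoord n t 0 = 0 := by
  simp [extCoord]

lemma extCoord_of_lt (n : ℕ) (t : Fin n → ℝ) {m : ℕ} (h : n < m) : extCoord n t m = 1 := by
  have h₁ : ¬ (1 ≤ m ∧ m ≤ n) := by omega
  have h₂ : m ≠ 0 := by omega
  simp [extCoord, h₁, h₂]

lemma extCoord_succ (n : ℕ) (t : Fin n → ℝ) (i : Fin n) : extCoord n t (i + 1) = t i := by
  have h : (i : ℕ) + 1 ≤ n := i.2
  simp [extCoord, h]

lemma mem_simplex01_iff_monotone_extCoord {n : ℕ} {t : Fin n → ℝ} :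
    t ∈ simplex01 n ↔ Monotone (extCoord n t) := by
  constructor
  · rintro ⟨h₁, h₂⟩
    refine monotone_nat_of_le_succ fun m => ?_
    rcases lt_or_ge n (m + 1) with hm | hm
    · rw [extCoord_of_lt n t hm]
      rcases lt_or_ge n m with hm' | hm'
      · rw [extCoord_of_lt n t hm']
      · rcases m with _ | m
        · rw [extCoord_zero]; exact zero_le_one
        · rw [extCoord_succ n t ⟨m, hm'⟩]
          exact (h₁ _).2
    · rw [extCoord_succ n t ⟨m, hm⟩]
      rcases m with _ | m
      · rw [extCoord_zero]; exact (h₁ _).1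
      · rw [extCoord_succ n t ⟨m, by omega⟩]
        exact h₂ _ _ (Fin.mk_le_mk.2 (Nat.le_succ m))
  · intro h
    refine ⟨fun i => ?_, fun i j hij => ?_⟩
    · rw [← extCoord_succ n t i]
      constructor
      · rw [← extCoord_zero n t]; exact h (Nat.zero_le _)
      · rw [← extCoord_of_lt n t (Nat.lt_succ_self n)]; exact h (by omega)
    · rw [← extCoord_succ n t i, ← extCoord_succ n t j]
      exact h (Nat.succ_le_succ hij)

lemma extCoord_prismMap_of_le {n j : ℕ} (h₁ : 1 ≤ j) (h₂ : j ≤ n + 1) (p : ℝ × (Fin n → ℝ))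
    {m : ℕ} (hm : 1 ≤ m) (hm' : m ≤ n + 2 - j) :
    extCoord (n + 1) (prismMap n j p) m = extCoord n p.2 (j + m - 1) + p.1 - 1 := by
  obtain ⟨k, rfl⟩ : ∃ k, m = k + 1 := ⟨m - 1, by omega⟩
  rw [extCoord_succ (n + 1) _ ⟨k, by omega⟩, prismMap]
  dsimp only
  split_ifs with h h'
  · rfl
  · rw [extCoord_of_lt n p.2 (by omega)]; ring
  · omega

lemma extCoord_prismMap_of_ge {n j : ℕ} (h₂ : j ≤ n + 1) (p : ℝ × (Fin n → ℝ))
    {m : ℕ} (hm : n + 2 - j ≤ m) (hm' : m ≤ n + 1) :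
    extCoord (n + 1) (prismMap n j p) m = extCoord n p.2 (m + j - n - 2) + p.1 := by
  obtain ⟨k, rfl⟩ : ∃ k, m = k + 1 := ⟨m - 1, by omega⟩
  rw [extCoord_succ (n + 1) _ ⟨k, by omega⟩, prismMap]
  dsimp only
  split_ifs with h h'
  · omega
  · rw [show k + 1 + j - n - 2 = 0 by omega, extCoord_zero]; ring
  · rfl

lemma prismMap_preimage_simplex01 {n j : ℕ} (h₁ : 1 ≤ j) (h₂ : j ≤ n + 1) :
    prismMap n j ⁻¹' simplex01 (n + 1) = prismPiece n j := by
  ext p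
  rw [Set.mem_preimage, mem_simplex01_iff_monotone_extCoord, prismPiece, Set.mem_ofPred_eq,
    mem_simplex01_iff_monotone_extCoord]
  have hE := fun m => extCoord_prismMap_of_le h₁ h₂ p (m := m)
  have hE' := fun m => extCoord_prismMap_of_ge h₂ p (m := m)
  have hE0 := extCoord_zero (n + 1) (prismMap n j p)
  have hEn := extCoord_of_lt (n + 1) (prismMap n j p) (Nat.lt_succ_self _)
  have he0 := extCoord_zero n p.2
  have hen := fun m => extCoord_of_lt n p.2 (m := m)
  have hb := hE 1 le_rfl (by omega)
  have ht := hE' (n + 1) (by omega) le_rfl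
  have hs := hE' (n + 2 - j) le_rfl (by omega)
  rw [show n + 2 - j + j - n - 2 = 0 by omega, he0] at hs
  rw [show j + 1 - 1 = j by omega] at hb
  rw [show n + 1 + j - n - 2 = j - 1 by omega] at ht
  constructor
  · intro h
    have a₁ := h (Nat.zero_le 1)
    have a₂ := h (Nat.le_succ (n + 1))
    have a₃ := h (Nat.zero_le (n + 2 - j))
    have a₄ := h (show n + 2 - j ≤ n + 2 by omega)
    simp only [Nat.succ_eq_add_one] at a₂ hEn
    refine ⟨monotone_nat_of_le_succ fun i => ?_, ⟨by linarith, by linarith⟩, by linarith,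
      by linarith⟩
    rcases lt_or_ge n i with hi | hi
    · rw [hen i hi, hen (i + 1) (by omega)]
    rcases lt_trichotomy (i + 1) j with hij | hij | hij
    · have b₁ := hE' (i + n + 2 - j) (by omega) (by omega)
      have b₂ := hE' (i + 1 + n + 2 - j) (by omega) (by omega)
      have b₃ := h (show i + n + 2 - j ≤ i + 1 + n + 2 - j by omega)
      rw [show i + n + 2 - j + j - n - 2 = i by omega] at b₁
      rw [show i + 1 + n + 2 - j + j - n - 2 = i + 1 by omega] at b₂
      linarith
    · rw [show j - 1 = i by omega] at ht
      rw [hij]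
      linarith
    · have b₁ := hE (i - j + 1) (by omega) (by omega)
      have b₂ := hE (i - j + 2) (by omega) (by omega)
      have b₃ := h (show i - j + 1 ≤ i - j + 2 by omega)
      rw [show j + (i - j + 1) - 1 = i by omega] at b₁
      rw [show j + (i - j + 2) - 1 = i + 1 by omega] at b₂
      linarith
  · rintro ⟨h, ⟨s₀, s₁⟩, c₁, c₂⟩
    refine monotone_nat_of_le_succ fun m => ?_
    rcases Nat.eq_zero_or_pos m with rfl | hm
    · rw [hE0, zero_add]; linarith
    rcases lt_or_ge (n + 1) m with hm' | hm'
    · rw [extCoord_of_lt _ _ hm', extCoord_of_lt _ _ (by omega)]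
    rcases Nat.eq_or_lt_of_le hm' with rfl | hm''
    · rw [hEn]; linarith
    rcases lt_or_ge m (n + 2 - j) with hmj | hmj
    · rw [hE m hm hmj.le, hE (m + 1) (by omega) hmj]
      have := h (show j + m - 1 ≤ j + (m + 1) - 1 by omega)
      linarith
    · rw [hE' m hmj hm', hE' (m + 1) (by omega) hm'']
      have := h (show m + j - n - 2 ≤ m + 1 + j - n - 2 by omega)
      linarith

/-- The shear `(s, t) ↦ (s, t')` with `t'_i = t_i + s - 1` for `i ≥ j` and `t'_i = t_i + s` for
`i < j` (`1`-based indexing). -/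
def prismShear (n j : ℕ) : ℝ × (Fin n → ℝ) ≃ ℝ × (Fin n → ℝ) :=
  Equiv.prodShear (Equiv.refl ℝ) fun s =>
    Equiv.addRight fun i : Fin n => s - if j ≤ (i : ℕ) + 1 then 1 else 0

lemma measurePreserving_prismShear (n j : ℕ) : MeasurePreserving (prismShear n j) := by
  refine (MeasurePreserving.id (volume : Measure ℝ)).skew_product
    (g := fun s (t : Fin n → ℝ) => t + fun i : Fin n => s - if j ≤ (i : ℕ) + 1 then 1 else 0)
    ?_ (Filter.Eventually.of_forall fun s => (measurePreserving_add_right volume _).map_eq)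
  exact measurable_pi_lambda _ fun i =>
    ((measurable_pi_apply i).comp measurable_snd).add (measurable_fst.sub_const _)

/-- Shear, prepend `s` to the tuple, and rotate the `n + 1` coordinates by `j`. -/
def prismEquiv (n j : ℕ) : ℝ × (Fin n → ℝ) ≃ (Fin (n + 1) → ℝ) :=
  ((prismShear n j).trans (MeasurableEquiv.piFinSuccAbove (fun _ => ℝ) 0).symm.toEquiv).trans
    (MeasurableEquiv.piCongrLeft (fun _ => ℝ)
      (Equiv.addRight (Fin.ofNat (n + 1) j)).symm).toEquiv

lemma measurePreserving_prismEquiv (n j : ℕ) : MeasurePreserving (prismEquiv n j) :=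
  (volume_measurePreserving_piCongrLeft (fun _ => ℝ) _).comp
    (((volume_preserving_piFinSuccAbove (fun _ => ℝ) 0).symm _).comp
      (measurePreserving_prismShear n j))

lemma prismEquiv_apply (n j : ℕ) (p : ℝ × (Fin n → ℝ)) (k : Fin (n + 1)) :
    prismEquiv n j p k
      = (Fin.cons p.1 (prismShear n j p).2 : Fin (n + 1) → ℝ) (k + Fin.ofNat (n + 1) j) := by
  have h := Equiv.piCongrLeft_apply_apply (fun _ => ℝ) (Equiv.addRight (Fin.ofNat (n + 1) j)).symm
    (Fin.cons p.1 (prismShear n j p).2) (k + Fin.ofNat (n + 1) j)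
  rw [show (Equiv.addRight (Fin.ofNat (n + 1) j)).symm (k + Fin.ofNat (n + 1) j) = k from
    (Equiv.addRight _).symm_apply_apply k] at h
  rw [← h, ← Fin.insertNth_zero']
  rfl

lemma coe_prismEquiv {n j : ℕ} (h₁ : 1 ≤ j) (h₂ : j ≤ n + 1) :
    ⇑(prismEquiv n j) = prismMap n j := by
  funext p k
  rw [prismEquiv_apply]
  have hk := k.2
  have hv : ((k + Fin.ofNat (n + 1) j : Fin (n + 1)) : ℕ) = (k + j) % (n + 1) := by
    simp [Fin.val_add]
  generalize k + Fin.ofNat (n + 1) j = l at hv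
  rw [prismMap]
  split_ifs with h h'
  · rw [Nat.mod_eq_of_lt (by omega)] at hv
    cases l using Fin.cases with
    | zero => simp at hv; omega
    | succ i =>
      rw [Fin.val_succ] at hv
      rw [Fin.cons_succ, show j + ((k : ℕ) + 1) - 1 = i + 1 by omega, extCoord_succ]
      have : j ≤ (i : ℕ) + 1 := by omega
      simp [prismShear, this]
      ring
  · rw [show (k : ℕ) + j = n + 1 by omega, Nat.mod_self] at hv
    obtain rfl : l = 0 := Fin.ext hv
    rfl
  · rw [Nat.mod_eq_sub_mod (by omega), Nat.mod_eq_of_lt (by omega)] at hv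
    cases l using Fin.cases with
    | zero => simp at hv; omega
    | succ i =>
      rw [Fin.val_succ] at hv
      rw [Fin.cons_succ, show (k : ℕ) + 1 + j - n - 2 = i + 1 by omega, extCoord_succ]
      have : ¬ j ≤ (i : ℕ) + 1 := by omega
      simp [prismShear, this]

lemma measurePreserving_prismMap {n j : ℕ} (h₁ : 1 ≤ j) (h₂ : j ≤ n + 1) :
    MeasurePreserving (prismMap n j) :=
  coe_prismEquiv h₁ h₂ ▸ measurePreserving_prismEquiv n j

lemma bijOn_prismMap {n j : ℕ} (h₁ : 1 ≤ j) (h₂ : j ≤ n + 1) :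
    Set.BijOn (prismMap n j) (prismPiece n j) (simplex01 (n + 1)) := by
  rw [← prismMap_preimage_simplex01 h₁ h₂, ← coe_prismEquiv h₁ h₂]
  exact ⟨fun _ h => h, (prismEquiv n j).injective.injOn,
    fun y hy => ⟨(prismEquiv n j).symm y, by simpa using hy, by simp⟩⟩

lemma measurableSet_simplex01 (n : ℕ) : MeasurableSet (simplex01 n) := by
  have : IsClosed (simplex01 n) := by
    simp only [simplex01, Set.ofPred_and, Set.ofPred_forall]
    refine .inter (isClosed_iInter fun i => .inter ?_ ?_)
      (isClosed_iInter fun i => isClosed_iInter fun j => isClosed_iInter fun _ => ?_)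
    all_goals exact isClosed_le (by fun_prop) (by fun_prop)
  exact this.measurableSet

lemma volume_prismPiece_inter_of_lt {n j k : ℕ} (h₁ : 1 ≤ j) (hjk : j < k) (h₂ : k ≤ n + 1) :
    volume (prismPiece n j ∩ prismPiece n k) = 0 := by
  have hnull : volume {τ : Fin (n + 1) → ℝ | τ 0 = 0} = 0 :=
    Measure.pi_hyperplane (fun _ => (volume : Measure ℝ)) 0 0
  refine measure_mono_null ?_
    ((measurePreserving_prismMap h₁ (by omega : j ≤ n + 1)).quasiMeasurePreserving.preimage_null
      hnull)
  rintro p ⟨⟨hp, -, -, hj⟩, -, -, hk, -⟩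
  have hm := mem_simplex01_iff_monotone_extCoord.1 hp (show j ≤ k - 1 by omega)
  have h := extCoord_prismMap_of_le h₁ (by omega : j ≤ n + 1) p le_rfl (by omega)
  have h' := extCoord_succ (n + 1) (prismMap n j p) 0
  rw [Fin.val_zero, zero_add, h, Nat.add_sub_cancel] at h'
  rw [Set.mem_preimage, Set.mem_ofPred_eq, ← h']
  linarith

lemma iUnion_prismPiece (n : ℕ) :
    (⋃ j ∈ Finset.Icc 1 (n + 1), prismPiece n j)
      = {p : ℝ × (Fin n → ℝ) | p.1 ∈ Set.Icc (0:ℝ) 1 ∧ p.2 ∈ simplex01 n} := by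
  ext p
  simp only [Set.mem_iUnion, Finset.mem_Icc, exists_prop, Set.mem_ofPred_eq]
  constructor
  · rintro ⟨j, -, hp, hs, -⟩
    exact ⟨hs, hp⟩
  · rintro ⟨hs, hp⟩
    classical
    have hlast : 1 ≤ n + 1 ∧ 1 ≤ extCoord n p.2 (n + 1) + p.1 := by
      rw [extCoord_of_lt n p.2 (Nat.lt_succ_self n)]
      exact ⟨by omega, by linarith [hs.1]⟩
    have hex : ∃ j, 1 ≤ j ∧ 1 ≤ extCoord n p.2 j + p.1 := ⟨_, hlast⟩
    obtain ⟨hj₁, hj₂⟩ := Nat.find_spec hex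
    refine ⟨Nat.find hex, ⟨hj₁, Nat.find_min' hex hlast⟩, hp, hs, ?_, hj₂⟩
    rcases Nat.eq_or_lt_of_le hj₁ with h | h
    · rw [← h, Nat.sub_self, extCoord_zero, zero_add]
      exact hs.2
    · have := Nat.find_min hex (show Nat.find hex - 1 < Nat.find hex by omega)
      by_contra! hlt
      exact this ⟨by omega, hlt.le⟩

/-- The pieces `D_1, …, D_{n+1}` cover the prism `[0,1] × Δ_n`, pairwise
intersect in Lebesgue-null sets, and each affine map `Φ_j` is a bijection from `D_j` onto the
standard simplex `Δ_{n+1}` up to null sets and preserves `(n+1)`-dimensional Lebesgue measure. -/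
theorem prism_simplex_decomposition (n : ℕ) :
    (⋃ j ∈ Finset.Icc 1 (n + 1), prismPiece n j)
        = {p : ℝ × (Fin n → ℝ) | p.1 ∈ Set.Icc (0:ℝ) 1 ∧ p.2 ∈ simplex01 n} ∧
    (∀ j ∈ Finset.Icc 1 (n + 1), ∀ k ∈ Finset.Icc 1 (n + 1), j ≠ k →
        volume (prismPiece n j ∩ prismPiece n k) = 0) ∧
    (∀ j ∈ Finset.Icc 1 (n + 1),
      (∃ (N₁ : Set (ℝ × (Fin n → ℝ))) (N₂ : Set (Fin (n + 1) → ℝ)),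
          volume N₁ = 0 ∧ volume N₂ = 0 ∧
          Set.BijOn (prismMap n j) (prismPiece n j \ N₁) (simplex01 (n + 1) \ N₂)) ∧
      MeasurePreserving (prismMap n j)
        (volume.restrict (prismPiece n j)) (volume.restrict (simplex01 (n + 1)))) := by
  refine ⟨iUnion_prismPiece n, fun j hj k hk hjk => ?_, fun j hj => ?_⟩
  · rw [Finset.mem_Icc] at hj hk
    rcases lt_or_gt_of_ne hjk with h | h
    · exact volume_prismPiece_inter_of_lt hj.1 h hk.2
    · rw [Set.inter_comm]
      exact volume_prismPiece_inter_of_lt hk.1 h hj.2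
  · obtain ⟨h₁, h₂⟩ := Finset.mem_Icc.1 hj
    refine ⟨⟨∅, ∅, measure_empty, measure_empty, ?_⟩, ?_⟩
    · simpa only [Set.sdiff_empty] using bijOn_prismMap h₁ h₂
    · rw [← prismMap_preimage_simplex01 h₁ h₂]
      exact (measurePreserving_prismMap h₁ h₂).restrict_preimage (measurableSet_simplex01 _)
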